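/- arXiv:2410.17904 — 2 statements merged into one kernel-verified Lean document; each statement's English description precedes it below -/
import Mathlib

section
/- Let M_lat be a base MDP over finite latent state space S and finite action space A with horizon H, let ψ* be a decodable emission process into a finite observation space X with decoder φ*, and let M_obs = ⟨M_lat, ψ*⟩. Let Π_lat be a nonempty set of latent policies and Φ a nonempty set of maps φ = {φ_h : X → S}. Then C_cov,st(M_obs, {π_lat∘φ : π_lat ∈ Π_lat, φ ∈ Φ}) = C_cov,st(M_lat, {Γ_φ∘π_lat : π_lat ∈ Π_lat, φ ∈ Φ}). Moreover, if μ_lat = {μ_lat,h ∈ Δ(S)} attains the right-hand side, then the distributions μ_obs,h(x) = ψ*_h(x|φ*_h(x))·μ_lat,h(φ*_h(x)) attain the left-hand side. -/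
open Finset ENNReal

attribute [local instance] Classical.propDecidable

/-- Occupancy measure of a finite-horizon MDP (layers 0-indexed). -/
noncomputable def docc {Z A : Type*} [Fintype Z] [Fintype A]
    (P0 : Z → ℝ) (P : ℕ → Z → A → Z → ℝ) (pol : ℕ → Z → A → ℝ) : ℕ → Z → ℝ
  | 0 => P0
  | h + 1 => fun z' => ∑ z, ∑ a, docc P0 P pol h z * pol h z a * P h z a z'

/-- Initial distribution of the latent-dynamics MDP `⟨M_lat, ψ⟩`; `ψ h s x = ψ_h(x|s)`. -/
noncomputable def obsInit {S X : Type*} (P0lat : S → ℝ) (ψ : ℕ → S → X → ℝ)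
    (φstar : ℕ → X → S) : X → ℝ :=
  fun x => P0lat (φstar 0 x) * ψ 0 (φstar 0 x) x

/-- Transition kernel of the latent-dynamics MDP `⟨M_lat, ψ⟩`. -/
noncomputable def obsTrans {S X A : Type*} (Plat : ℕ → S → A → S → ℝ)
    (ψ : ℕ → S → X → ℝ) (φstar : ℕ → X → S) : ℕ → X → A → X → ℝ :=
  fun h x a x' => Plat h (φstar h x) a (φstar (h + 1) x') * ψ (h + 1) (φstar (h + 1) x') x'

/-- Composition `π_lat ∘ φ` of a latent policy with a decoder:
`(π_lat∘φ)_h(a|x) = π_lat,h(a|φ_h(x))`. -/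
def compPol {S X A : Type*} (pol : ℕ → S → A → ℝ) (φ : ℕ → X → S) : ℕ → X → A → ℝ :=
  fun h x a => pol h (φ h x) a

/-- Mismatch function `Γ_{φ,h}(s'|s) = Σ_{x : φ_h(x)=s'} ψ_h(x|s)`
(arguments: `mismatch ψ φ h s s' = Γ_{φ,h}(s'|s)`). -/
noncomputable def mismatch {S X : Type*} [Fintype X] [DecidableEq S]
    (ψ : ℕ → S → X → ℝ) (φ : ℕ → X → S) : ℕ → S → S → ℝ :=
  fun h s s' => ∑ x ∈ Finset.univ.filter (fun x => φ h x = s'), ψ h s x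

/-- The latent policy `Γ_φ ∘ π_lat`: `(Γ_φ∘π_lat)_h(a|s) = Σ_{s'} Γ_{φ,h}(s'|s)·π_lat,h(a|s')`. -/
noncomputable def mismatchPol {S X A : Type*} [Fintype X] [Fintype S] [DecidableEq S]
    (ψ : ℕ → S → X → ℝ) (φ : ℕ → X → S) (pol : ℕ → S → A → ℝ) : ℕ → S → A → ℝ :=
  fun h s a => ∑ s', mismatch ψ φ h s s' * pol h s' a

section Emission

variable {S X : Type*} [Fintype X] {w : S → X → ℝ≥0∞} {f : X → S}

lemma sum_emission_mul [Fintype S] {R : Type*} [Semiring R] {ψ : S → X → R}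
    (hf : ∀ s x, ψ s x ≠ 0 → f x = s) (g : S → X → R) :
    ∑ x, ψ (f x) x * g (f x) x = ∑ s, ∑ x, ψ s x * g s x := by
  rw [Finset.sum_comm]
  refine Finset.sum_congr rfl fun x _ => ?_
  rw [Fintype.sum_eq_single (f x)]
  intro s hs
  have : ψ s x = 0 := by
    by_contra h
    exact hs (hf s x h).symm
  simp [this]

lemma iSup_emission_div (hw : ∀ s, ∑ x, w s x = 1) (hf : ∀ s x, w s x ≠ 0 → f x = s)
    (D μ : S → ℝ≥0∞) :
    ⨆ x, w (f x) x * D (f x) / (w (f x) x * μ (f x)) = ⨆ s, D s / μ s := by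
  have htop : ∀ s x, w s x ≠ ⊤ := fun s x =>
    ((Finset.single_le_sum (f := w s) (fun _ _ => zero_le) (Finset.mem_univ x)).trans_lt
      (by rw [hw s]; exact ENNReal.one_lt_top)).ne
  apply le_antisymm
  · refine iSup_le fun x => ?_
    by_cases h0 : w (f x) x = 0
    · simp [h0]
    · rw [ENNReal.mul_div_mul_left _ _ h0 (htop _ _)]
      exact le_iSup (fun s => D s / μ s) (f x)
  · refine iSup_le fun s => ?_
    obtain ⟨x, -, hx⟩ := Finset.exists_ne_zero_of_sum_ne_zero (s := Finset.univ) (f := w s)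
      (by simp [hw s])
    obtain rfl := hf s x hx
    rw [← ENNReal.mul_div_mul_left _ _ hx (htop _ _)]
    exact le_iSup (fun x => w (f x) x * D (f x) / (w (f x) x * μ (f x))) x

lemma iSup_div_pushforward_le (hw : ∀ s, ∑ x, w s x = 1) (hf : ∀ s x, w s x ≠ 0 → f x = s)
    (D : S → ℝ≥0∞) (μ : X → ℝ≥0∞) (hμ : ∀ x, μ x ≠ ⊤) :
    ⨆ s, D s / (∑ x with f x = s, μ x) ≤ ⨆ x, w (f x) x * D (f x) / μ x := by
  set C := ⨆ x, w (f x) x * D (f x) / μ x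
  by_cases hCtop : C = ⊤
  · simp [hCtop]
  refine iSup_le fun s => ENNReal.div_le_of_le_mul ?_
  have hle : ∀ x, w (f x) x * D (f x) ≤ C * μ x := fun x =>
    (ENNReal.div_le_iff_le_mul (Or.inr hCtop) (Or.inl (hμ x))).1
      (le_iSup (fun x => w (f x) x * D (f x) / μ x) x)
  calc D s = ∑ x, w s x * D s := by rw [← Finset.sum_mul, hw s, one_mul]
    _ = ∑ x with f x = s, w s x * D s := by
      refine (Finset.sum_filter_of_ne fun x _ hx => hf s x ?_).symm
      exact left_ne_zero_of_mul hx
    _ ≤ ∑ x with f x = s, C * μ x := by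
      refine Finset.sum_le_sum fun x hx => ?_
      obtain rfl := (Finset.mem_filter.1 hx).2
      exact hle x
    _ = C * ∑ x with f x = s, μ x := (Finset.mul_sum _ _ _).symm

lemma sum_emission_mul_eq_one [Fintype S] (hw : ∀ s, ∑ x, w s x = 1)
    (hf : ∀ s x, w s x ≠ 0 → f x = s) {μ : S → ℝ≥0∞} (hμ : ∑ s, μ s = 1) :
    ∑ x, w (f x) x * μ (f x) = 1 := by
  rw [sum_emission_mul hf fun s _ => μ s]
  simp only [← Finset.sum_mul, hw, one_mul, hμ]

/-- The optimal coverability constant of a family of state distributions is unchanged when each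
distribution is pushed through a decodable emission `w`. -/
lemma iInf_iSup_emission_div [Fintype S] {ι κ : Type*} (I : Set ι) (K : Set κ)
    (hw : ∀ s, ∑ x, w s x = 1) (hf : ∀ s x, w s x ≠ 0 → f x = s) (D : ι → κ → S → ℝ≥0∞) :
    (⨅ μ : {μ : X → ℝ≥0∞ // ∑ x, μ x = 1},
        ⨆ i ∈ I, ⨆ k ∈ K, ⨆ x, w (f x) x * D i k (f x) / μ.1 x)
      = ⨅ μ : {μ : S → ℝ≥0∞ // ∑ s, μ s = 1},
        ⨆ i ∈ I, ⨆ k ∈ K, ⨆ s, D i k s / μ.1 s := by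
  apply le_antisymm
  · refine le_iInf fun μ => ?_
    refine (iInf_le _ ⟨fun x => w (f x) x * μ.1 (f x), sum_emission_mul_eq_one hw hf μ.2⟩).trans ?_
    simp only [iSup_emission_div hw hf, le_refl]
  · refine le_iInf fun μ => ?_
    have hμ : ∀ x, μ.1 x ≠ ⊤ := fun x =>
      ((Finset.single_le_sum (f := μ.1) (fun _ _ => zero_le) (Finset.mem_univ x)).trans_lt
        (by rw [μ.2]; exact ENNReal.one_lt_top)).ne
    refine (iInf_le _ ⟨fun s => ∑ x with f x = s, μ.1 x,
      (Finset.sum_fiberwise _ _ _).trans μ.2⟩).trans ?_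
    exact iSup₂_mono fun i _ => iSup₂_mono fun k _ =>
      iSup_div_pushforward_le hw hf (D i k) μ.1 hμ

end Emission

lemma mismatchPol_eq_sum {S X A : Type*} [Fintype S] [Fintype X] [DecidableEq S]
    (ψ : ℕ → S → X → ℝ) (φ : ℕ → X → S) (pol : ℕ → S → A → ℝ) (h : ℕ) (s : S) (a : A) :
    mismatchPol ψ φ pol h s a = ∑ x, ψ h s x * compPol pol φ h x a := by
  simp only [mismatchPol, mismatch, compPol, Finset.sum_mul]
  rw [← Finset.sum_fiberwise Finset.univ (φ h)]
  refine Finset.sum_congr rfl fun s' _ => Finset.sum_congr (by congr) fun x hx => ?_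
  rw [(Finset.mem_filter.1 hx).2]

lemma docc_obs_eq {S X A : Type*} [Fintype S] [Fintype X] [Fintype A] [DecidableEq S]
    {H : ℕ} (P0lat : S → ℝ) (Plat : ℕ → S → A → S → ℝ) (ψ : ℕ → S → X → ℝ) (φstar : ℕ → X → S)
    (hφstar : ∀ h, h < H → ∀ s x, ψ h s x ≠ 0 → φstar h x = s)
    (pol : ℕ → S → A → ℝ) (φ : ℕ → X → S) (h : ℕ) (hh : h < H) (x : X) :
    docc (obsInit P0lat ψ φstar) (obsTrans Plat ψ φstar) (compPol pol φ) h x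
      = ψ h (φstar h x) x * docc P0lat Plat (mismatchPol ψ φ pol) h (φstar h x) := by
  induction h generalizing x with
  | zero => simp [docc, obsInit, mul_comm]
  | succ h ih =>
    have hh' : h < H := by omega
    simp only [docc, ih hh', obsTrans]
    set d := docc P0lat Plat (mismatchPol ψ φ pol) h
    set s' := φstar (h + 1) x
    calc _ = ∑ y, ψ h (φstar h y) y * ∑ a, d (φstar h y) * compPol pol φ h y a
            * (Plat h (φstar h y) a s' * ψ (h + 1) s' x) := by
          refine Finset.sum_congr rfl fun y _ => ?_
          rw [Finset.mul_sum]
          exact Finset.sum_congr rfl fun a _ => by ring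
      _ = ∑ s, ∑ y, ψ h s y * ∑ a, d s * compPol pol φ h y a
            * (Plat h s a s' * ψ (h + 1) s' x) :=
          sum_emission_mul (hφstar h hh') fun s y => ∑ a, d s * compPol pol φ h y a
            * (Plat h s a s' * ψ (h + 1) s' x)
      _ = _ := by
          rw [Finset.mul_sum]
          refine Finset.sum_congr rfl fun s _ => ?_
          simp only [Finset.mul_sum, mismatchPol_eq_sum, Finset.sum_mul]
          rw [Finset.sum_comm]
          exact Finset.sum_congr rfl fun a _ => Finset.sum_congr rfl fun y _ => by ring

/-- State coverability is invariant to rich observations: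
`C_cov,st(M_obs, {π_lat∘φ}) = C_cov,st(M_lat, {Γ_φ∘π_lat})` (policies ranging over
`π_lat ∈ Π_lat`, `φ ∈ Phi`), where `M_obs = ⟨M_lat, ψ*⟩`.  Moreover, if `μ_lat,h` attains
the right-hand side at every layer, then
`μ_obs,h(x) = ψ*_h(x|φ*_h(x))·μ_lat,h(φ*_h(x))` is a probability distribution attaining
the left-hand side.  Ratios in `ℝ≥0∞` (`c/0 = ∞` for `c > 0`, `0/0 = 0`). -/
theorem statement8 (S X A : Type*) [Fintype S] [Fintype X] [Fintype A] [DecidableEq S]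
    [Nonempty S] [Nonempty X] [Nonempty A]
    (H : ℕ) (hH : 0 < H)
    (P0lat : S → ℝ) (h00 : ∀ s, 0 ≤ P0lat s) (h01 : ∑ s, P0lat s = 1)
    (Plat : ℕ → S → A → S → ℝ)
    (hPnn : ∀ h, h + 1 < H → ∀ s a s', 0 ≤ Plat h s a s')
    (hPsum : ∀ h, h + 1 < H → ∀ s a, ∑ s', Plat h s a s' = 1)
    (ψ : ℕ → S → X → ℝ)
    (hψnn : ∀ h, h < H → ∀ s x, 0 ≤ ψ h s x)
    (hψsum : ∀ h, h < H → ∀ s, ∑ x, ψ h s x = 1)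
    (hdec : ∀ h, h < H → ∀ s s' x, s ≠ s' → ψ h s x ≠ 0 → ψ h s' x = 0)
    (φstar : ℕ → X → S)
    (hφstar : ∀ h, h < H → ∀ s x, ψ h s x ≠ 0 → φstar h x = s)
    (PiLat : Set (ℕ → S → A → ℝ)) (hPine : PiLat.Nonempty)
    (hPival : ∀ π ∈ PiLat, ∀ h, h < H → ∀ s, (∀ a, 0 ≤ π h s a) ∧ ∑ a, π h s a = 1)
    (Phi : Set (ℕ → X → S)) (hPhine : Phi.Nonempty) :
    (⨆ (h : ℕ) (_ : h < H), ⨅ μ : {μ : X → ℝ≥0∞ // ∑ x, μ x = 1},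
        ⨆ π ∈ PiLat, ⨆ φ ∈ Phi, ⨆ x : X,
          ENNReal.ofReal
              (docc (obsInit P0lat ψ φstar) (obsTrans Plat ψ φstar) (compPol π φ) h x)
            / μ.1 x)
      = (⨆ (h : ℕ) (_ : h < H), ⨅ μ : {μ : S → ℝ≥0∞ // ∑ s, μ s = 1},
          ⨆ π ∈ PiLat, ⨆ φ ∈ Phi, ⨆ s : S,
            ENNReal.ofReal (docc P0lat Plat (mismatchPol ψ φ π) h s) / μ.1 s)
    ∧ ∀ μlat : ℕ → S → ℝ≥0∞,
        (∀ h, h < H → ∑ s, μlat h s = 1) →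
        (∀ h, h < H →
          (⨆ π ∈ PiLat, ⨆ φ ∈ Phi, ⨆ s : S,
              ENNReal.ofReal (docc P0lat Plat (mismatchPol ψ φ π) h s) / μlat h s)
            = ⨅ μ : {μ : S → ℝ≥0∞ // ∑ s, μ s = 1},
                ⨆ π ∈ PiLat, ⨆ φ ∈ Phi, ⨆ s : S,
                  ENNReal.ofReal (docc P0lat Plat (mismatchPol ψ φ π) h s) / μ.1 s) →
        ∀ h, h < H →
          (∑ x, ENNReal.ofReal (ψ h (φstar h x) x) * μlat h (φstar h x) = 1)
          ∧ (⨆ π ∈ PiLat, ⨆ φ ∈ Phi, ⨆ x : X,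
              ENNReal.ofReal
                  (docc (obsInit P0lat ψ φstar) (obsTrans Plat ψ φstar) (compPol π φ) h x)
                / (ENNReal.ofReal (ψ h (φstar h x) x) * μlat h (φstar h x)))
            = ⨅ μ : {μ : X → ℝ≥0∞ // ∑ x, μ x = 1},
                ⨆ π ∈ PiLat, ⨆ φ ∈ Phi, ⨆ x : X,
                  ENNReal.ofReal
                      (docc (obsInit P0lat ψ φstar) (obsTrans Plat ψ φstar) (compPol π φ) h x)
                    / μ.1 x := by
  have hw : ∀ h, h < H → ∀ s, ∑ x, ENNReal.ofReal (ψ h s x) = 1 := fun h hh s => by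
    rw [← ENNReal.ofReal_sum_of_nonneg fun x _ => hψnn h hh s x, hψsum h hh s, ENNReal.ofReal_one]
  have hf : ∀ h, h < H → ∀ s x, ENNReal.ofReal (ψ h s x) ≠ 0 → φstar h x = s :=
    fun h hh s x hx => hφstar h hh s x fun h0 => hx (by simp [h0])
  have hd : ∀ h, h < H → ∀ π φ x,
      ENNReal.ofReal (docc (obsInit P0lat ψ φstar) (obsTrans Plat ψ φstar) (compPol π φ) h x)
        = ENNReal.ofReal (ψ h (φstar h x) x)
          * ENNReal.ofReal (docc P0lat Plat (mismatchPol ψ φ π) h (φstar h x)) :=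
    fun h hh π φ x => by
      rw [docc_obs_eq P0lat Plat ψ φstar hφstar π φ h hh x,
        ENNReal.ofReal_mul (hψnn h hh _ x)]
  have hlayer := fun h (hh : h < H) => iInf_iSup_emission_div PiLat Phi (hw h hh) (hf h hh)
    fun π φ s => ENNReal.ofReal (docc P0lat Plat (mismatchPol ψ φ π) h s)
  refine ⟨iSup_congr fun h => iSup_congr fun hh => ?_, fun μlat hμ hopt h hh => ⟨?_, ?_⟩⟩
  · simp only [hd h hh]
    exact hlayer h hh
  · exact sum_emission_mul_eq_one (hw h hh) (hf h hh) (hμ h hh)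
  · simp only [hd h hh]
    rw [hlayer h hh, ← hopt h hh]
    refine iSup_congr fun π => iSup_congr fun _ => iSup_congr fun φ => iSup_congr fun _ => ?_
    exact iSup_emission_div (hw h hh) (hf h hh)
      (fun s => ENNReal.ofReal (docc P0lat Plat (mismatchPol ψ φ π) h s)) (μlat h)
end

section
/- Let M*_lat be a base MDP over finite latent state space S and finite action space A with horizon H, let ψ* be a decodable emission process into a finite observation space X with decoder φ*, and let M*_obs = ⟨M*_lat, ψ*⟩. Let M_lat be any base MDP over S with initial distribution P_lat,0 and kernels P_lat,h, let π_lat be a latent policy, and let φ = {φ_h : X → S} be any map. Then for every h ∈ [H]: Σ_{(s,a)∈S×A} | d^{M_lat,π_lat}_h(s,a) − Σ_{x : φ_h(x)=s} d^{M*_obs, π_lat∘φ}_h(x,a) | ≤ Σ_{s∈S} | P_lat,0(s) − Σ_{x : φ_1(x)=s} P*_obs,0(x) | + Σ_{h'=1}^{h−1} Σ_{(x,a)} d^{M*_obs,π_lat∘φ}_{h'}(x,a) · Σ_{s'∈S} | P_lat,h'(s'|φ_{h'}(x),a) − Σ_{x' : φ_{h'+1}(x')=s'} P*_obs,h'(x'|x,a)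 |. Consequently, for every f : S × A → [0,1], | E^{M_lat,π_lat}[f(s_h,a_h)] − E^{M*_obs,π_lat∘φ}[f(φ_h(x_h),a_h)] | is bounded by the same right-hand side. -/
open Finset

attribute [local instance] Classical.propDecidable

theorem docc_nonneg {Z A : Type*} [Fintype Z] [Fintype A] {H : ℕ}
    {P0 : Z → ℝ} {P : ℕ → Z → A → Z → ℝ} {pol : ℕ → Z → A → ℝ}
    (hP0 : ∀ z, 0 ≤ P0 z) (hP : ∀ h, h + 1 < H → ∀ z a z', 0 ≤ P h z a z')
    (hpol : ∀ h, h < H → ∀ z a, 0 ≤ pol h z a) :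
    ∀ h, h < H → ∀ z, 0 ≤ docc P0 P pol h z := by
  intro h
  induction h with
  | zero => exact fun _ => hP0
  | succ h ih =>
    intro hh z'
    exact Finset.sum_nonneg fun z _ => Finset.sum_nonneg fun a _ =>
      mul_nonneg (mul_nonneg (ih (by omega) z) (hpol h (by omega) z a)) (hP h hh z a z')

/-- Integrating against the pushforward of `D` along `φ`. -/
theorem sum_pushforward_mul {S X : Type*} [Fintype S] [Fintype X] (φ : X → S) (D : X → ℝ)
    (g : S → ℝ) :
    ∑ s, (∑ x ∈ Finset.univ.filter (fun x => φ x = s), D x) * g s = ∑ x, D x * g (φ x) := by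
  rw [← Finset.sum_fiberwise Finset.univ φ (fun x => D x * g (φ x))]
  refine Finset.sum_congr rfl fun s _ => ?_
  rw [Finset.sum_mul]
  refine Finset.sum_congr rfl fun x hx => ?_
  rw [(Finset.mem_filter.mp hx).2]

/-- Since the composed policy depends on `x` only through `φ x`, the state-action discrepancy
collapses to the state discrepancy. -/
theorem sum_abs_stateAction_sub {S X A : Type*} [Fintype S] [Fintype X] [Fintype A]
    (φ : X → S) (d : S → ℝ) (D : X → ℝ) (p : S → A → ℝ)
    (hp : ∀ s, (∀ a, 0 ≤ p s a) ∧ ∑ a, p s a = 1) :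
    ∑ s, ∑ a, |d s * p s a - ∑ x ∈ Finset.univ.filter (fun x => φ x = s), D x * p (φ x) a|
      = ∑ s, |d s - ∑ x ∈ Finset.univ.filter (fun x => φ x = s), D x| := by
  refine Finset.sum_congr rfl fun s _ => ?_
  have key : ∀ a,
      |d s * p s a - ∑ x ∈ Finset.univ.filter (fun x => φ x = s), D x * p (φ x) a|
        = |d s - ∑ x ∈ Finset.univ.filter (fun x => φ x = s), D x| * p s a := by
    intro a
    have hsum : ∑ x ∈ Finset.univ.filter (fun x => φ x = s), D x * p (φ x) a
        = (∑ x ∈ Finset.univ.filter (fun x => φ x = s), D x) * p s a := by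
      rw [Finset.sum_mul]
      refine Finset.sum_congr rfl fun x hx => ?_
      rw [(Finset.mem_filter.mp hx).2]
    rw [hsum, ← sub_mul, abs_mul, abs_of_nonneg ((hp s).1 a)]
  rw [Finset.sum_congr rfl fun a _ => key a, ← Finset.mul_sum, (hp s).2, mul_one]

/-- One step of the simulation lemma. -/
theorem sum_abs_step_le {S X A : Type*} [Fintype S] [Fintype X] [Fintype A]
    (φ φ' : X → S) (d : S → ℝ) (D : X → ℝ) (hD : ∀ x, 0 ≤ D x) (p : S → A → ℝ)
    (hp : ∀ s, (∀ a, 0 ≤ p s a) ∧ ∑ a, p s a = 1)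
    (P : S → A → S → ℝ) (hPnn : ∀ s a s', 0 ≤ P s a s') (hPsum : ∀ s a, ∑ s', P s a s' = 1)
    (Q : X → A → X → ℝ) :
    ∑ s', |(∑ s, ∑ a, d s * p s a * P s a s')
        - ∑ x' ∈ Finset.univ.filter (fun x' => φ' x' = s'),
            ∑ x, ∑ a, D x * p (φ x) a * Q x a x'|
      ≤ (∑ s, |d s - ∑ x ∈ Finset.univ.filter (fun x => φ x = s), D x|)
        + ∑ x, ∑ a, D x * p (φ x) a *
            ∑ s', |P (φ x) a s' - ∑ x' ∈ Finset.univ.filter (fun x' => φ' x' = s'), Q x a x'| := by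
  set m : S → ℝ := fun s => ∑ x ∈ Finset.univ.filter (fun x => φ x = s), D x with hm
  set T : X → A → S → ℝ :=
    fun x a s' => ∑ x' ∈ Finset.univ.filter (fun x' => φ' x' = s'), Q x a x' with hT
  have decomp : ∀ s', (∑ s, ∑ a, d s * p s a * P s a s')
        - ∑ x' ∈ Finset.univ.filter (fun x' => φ' x' = s'),
            ∑ x, ∑ a, D x * p (φ x) a * Q x a x'
      = (∑ s, ∑ a, (d s - m s) * p s a * P s a s')
        + ∑ x, ∑ a, D x * p (φ x) a * (P (φ x) a s' - T x a s') := by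
    intro s'
    have h1 : ∑ x' ∈ Finset.univ.filter (fun x' => φ' x' = s'),
          ∑ x, ∑ a, D x * p (φ x) a * Q x a x'
        = ∑ x, ∑ a, D x * p (φ x) a * T x a s' := by
      rw [Finset.sum_comm]
      refine Finset.sum_congr rfl fun x _ => ?_
      rw [Finset.sum_comm]
      refine Finset.sum_congr rfl fun a _ => ?_
      rw [hT, Finset.mul_sum]
    have h2 : ∑ s, ∑ a, m s * p s a * P s a s'
        = ∑ x, ∑ a, D x * p (φ x) a * P (φ x) a s' := by
      have := sum_pushforward_mul φ D (fun s => ∑ a, p s a * P s a s')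
      simpa only [Finset.mul_sum, ← mul_assoc] using this
    simp only [sub_mul, mul_sub, Finset.sum_sub_distrib]
    rw [h1, h2]
    ring
  have first : ∑ s', |∑ s, ∑ a, (d s - m s) * p s a * P s a s'| ≤ ∑ s, |d s - m s| := by
    calc ∑ s', |∑ s, ∑ a, (d s - m s) * p s a * P s a s'|
        ≤ ∑ s', ∑ s, ∑ a, |d s - m s| * p s a * P s a s' := by
          refine Finset.sum_le_sum fun s' _ => (Finset.abs_sum_le_sum_abs _ _).trans ?_
          refine Finset.sum_le_sum fun s _ => (Finset.abs_sum_le_sum_abs _ _).trans ?_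
          refine Finset.sum_le_sum fun a _ => ?_
          rw [abs_mul, abs_mul, abs_of_nonneg ((hp s).1 a), abs_of_nonneg (hPnn s a s')]
      _ = ∑ s, |d s - m s| := by
          rw [Finset.sum_comm]
          refine Finset.sum_congr rfl fun s _ => ?_
          rw [Finset.sum_comm]
          simp only [← Finset.mul_sum, hPsum, mul_one, (hp s).2]
  have second : ∑ s', |∑ x, ∑ a, D x * p (φ x) a * (P (φ x) a s' - T x a s')|
      ≤ ∑ x, ∑ a, D x * p (φ x) a * ∑ s', |P (φ x) a s' - T x a s'| := by
    calc ∑ s', |∑ x, ∑ a, D x * p (φ x) a * (P (φ x) a s' - T x a s')|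
        ≤ ∑ s', ∑ x, ∑ a, D x * p (φ x) a * |P (φ x) a s' - T x a s'| := by
          refine Finset.sum_le_sum fun s' _ => (Finset.abs_sum_le_sum_abs _ _).trans ?_
          refine Finset.sum_le_sum fun x _ => (Finset.abs_sum_le_sum_abs _ _).trans ?_
          refine Finset.sum_le_sum fun a _ => ?_
          rw [abs_mul, abs_mul, abs_of_nonneg ((hp (φ x)).1 a), abs_of_nonneg (hD x)]
      _ = ∑ x, ∑ a, D x * p (φ x) a * ∑ s', |P (φ x) a s' - T x a s'| := by
          rw [Finset.sum_comm]
          refine Finset.sum_congr rfl fun x _ => ?_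
          rw [Finset.sum_comm]
          simp only [← Finset.mul_sum]
  simp only [decomp]
  refine (Finset.sum_le_sum fun s' _ => abs_add_le _ _).trans ?_
  rw [Finset.sum_add_distrib]
  exact add_le_add first second

/-- Simulation lemma for the state occupancies, with an arbitrary model `(Q0, Q)` over `X`. -/
theorem sum_abs_docc_sub_pushforward_le {S X A : Type*} [Fintype S] [Fintype X] [Fintype A]
    {H : ℕ} {Q0 : X → ℝ} (hQ0 : ∀ x, 0 ≤ Q0 x)
    {Q : ℕ → X → A → X → ℝ} (hQ : ∀ h, h + 1 < H → ∀ x a x', 0 ≤ Q h x a x')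
    (P0 : S → ℝ) {P : ℕ → S → A → S → ℝ}
    (hPnn : ∀ h, h + 1 < H → ∀ s a s', 0 ≤ P h s a s')
    (hPsum : ∀ h, h + 1 < H → ∀ s a, ∑ s', P h s a s' = 1)
    {π : ℕ → S → A → ℝ} (hπ : ∀ h, h < H → ∀ s, (∀ a, 0 ≤ π h s a) ∧ ∑ a, π h s a = 1)
    (φ : ℕ → X → S) (h : ℕ) (hh : h < H) :
    ∑ s, |docc P0 P π h s - ∑ x ∈ Finset.univ.filter (fun x => φ h x = s),
        docc Q0 Q (compPol π φ) h x|
      ≤ (∑ s, |P0 s - ∑ x ∈ Finset.univ.filter (fun x => φ 0 x = s), Q0 x|)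
        + ∑ k ∈ Finset.range h, ∑ x, ∑ a,
            docc Q0 Q (compPol π φ) k x * compPol π φ k x a *
              ∑ s', |P k (φ k x) a s'
                - ∑ x' ∈ Finset.univ.filter (fun x' => φ (k + 1) x' = s'), Q k x a x'| := by
  induction h with
  | zero => simp [docc]
  | succ h ih =>
    have hD := docc_nonneg (pol := compPol π φ) hQ0 hQ
      (fun k hk x a => (hπ k hk (φ k x)).1 a) h (by omega)
    have step := sum_abs_step_le (φ h) (φ (h + 1)) (docc P0 P π h) _ hD (π h) (hπ h (by omega))
      (P h) (hPnn h hh) (hPsum h hh) (Q h)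
    rw [Finset.sum_range_succ, ← add_assoc]
    exact step.trans (add_le_add_left (ih (by omega)) _)

/-- The gap between expectations of a `[0,1]`-valued function is at most the `L₁` distance. -/
theorem abs_expectation_sub_le {S X A : Type*} [Fintype S] [Fintype X] [Fintype A]
    (φ : X → S) (u : S → A → ℝ) (v : X → A → ℝ) (f : S → A → ℝ)
    (hf : ∀ s a, f s a ∈ Set.Icc (0 : ℝ) 1) :
    |(∑ s, ∑ a, u s a * f s a) - ∑ x, ∑ a, v x a * f (φ x) a|
      ≤ ∑ s, ∑ a, |u s a - ∑ x ∈ Finset.univ.filter (fun x => φ x = s), v x a| := by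
  have hv : ∑ x, ∑ a, v x a * f (φ x) a
      = ∑ s, ∑ a, (∑ x ∈ Finset.univ.filter (fun x => φ x = s), v x a) * f s a := by
    rw [Finset.sum_comm, Finset.sum_comm (γ := S)]
    exact Finset.sum_congr rfl fun a _ =>
      (sum_pushforward_mul φ (fun x => v x a) (fun s => f s a)).symm
  rw [hv, ← Finset.sum_sub_distrib]
  refine (Finset.abs_sum_le_sum_abs _ _).trans (Finset.sum_le_sum fun s _ => ?_)
  rw [← Finset.sum_sub_distrib]
  refine (Finset.abs_sum_le_sum_abs _ _).trans (Finset.sum_le_sum fun a _ => ?_)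
  rw [← sub_mul, abs_mul, abs_of_nonneg (hf s a).1]
  exact mul_le_of_le_one_right (abs_nonneg _) (hf s a).2

/-- Simulation lemma: the (state-action) occupancy of any base MDP
`M_lat` under a latent policy `π_lat` and the `φ`-image of the occupancy of
`M*_obs = ⟨M*_lat, ψ*⟩` under `π_lat∘φ` differ in `L₁` by at most the initial
discrepancy plus the accumulated one-step transition discrepancies, and consequently
expectations of any `f : S × A → [0,1]` differ by at most the same bound.
(Layers 0-indexed: `h < H`.) -/
theorem statement13 (S X A : Type*) [Fintype S] [Fintype X] [Fintype A]
    [Nonempty S] [Nonempty X] [Nonempty A]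
    (H : ℕ) (hH : 0 < H)
    -- the true latent model M*_lat and emission process
    (P0latStar : S → ℝ) (h00 : ∀ s, 0 ≤ P0latStar s) (h01 : ∑ s, P0latStar s = 1)
    (PlatStar : ℕ → S → A → S → ℝ)
    (hPnnStar : ∀ h, h + 1 < H → ∀ s a s', 0 ≤ PlatStar h s a s')
    (hPsumStar : ∀ h, h + 1 < H → ∀ s a, ∑ s', PlatStar h s a s' = 1)
    (ψ : ℕ → S → X → ℝ)
    (hψnn : ∀ h, h < H → ∀ s x, 0 ≤ ψ h s x)
    (hψsum : ∀ h, h < H → ∀ s, ∑ x, ψ h s x = 1)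
    (hdec : ∀ h, h < H → ∀ s s' x, s ≠ s' → ψ h s x ≠ 0 → ψ h s' x = 0)
    (φstar : ℕ → X → S)
    (hφstar : ∀ h, h < H → ∀ s x, ψ h s x ≠ 0 → φstar h x = s)
    -- an arbitrary base MDP M_lat over S
    (P0lat : S → ℝ) (hq0 : ∀ s, 0 ≤ P0lat s) (hq1 : ∑ s, P0lat s = 1)
    (Plat : ℕ → S → A → S → ℝ)
    (hPnn : ∀ h, h + 1 < H → ∀ s a s', 0 ≤ Plat h s a s')
    (hPsum : ∀ h, h + 1 < H → ∀ s a, ∑ s', Plat h s a s' = 1)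
    -- a latent policy and a map φ
    (π : ℕ → S → A → ℝ)
    (hπ : ∀ h, h < H → ∀ s, (∀ a, 0 ≤ π h s a) ∧ ∑ a, π h s a = 1)
    (φ : ℕ → X → S)
    (h : ℕ) (hh : h < H) :
    (∑ s, ∑ a,
        |docc P0lat Plat π h s * π h s a
          - ∑ x ∈ Finset.univ.filter (fun x => φ h x = s),
              docc (obsInit P0latStar ψ φstar) (obsTrans PlatStar ψ φstar) (compPol π φ) h x
                * compPol π φ h x a|
      ≤ (∑ s, |P0lat s - ∑ x ∈ Finset.univ.filter (fun x => φ 0 x = s),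
            obsInit P0latStar ψ φstar x|)
        + ∑ k ∈ Finset.range h, ∑ x, ∑ a,
            docc (obsInit P0latStar ψ φstar) (obsTrans PlatStar ψ φstar) (compPol π φ) k x
              * compPol π φ k x a *
              ∑ s', |Plat k (φ k x) a s'
                - ∑ x' ∈ Finset.univ.filter (fun x' => φ (k + 1) x' = s'),
                    obsTrans PlatStar ψ φstar k x a x'|)
    ∧ ∀ f : S → A → ℝ, (∀ s a, f s a ∈ Set.Icc (0 : ℝ) 1) →
        |(∑ s, ∑ a, docc P0lat Plat π h s * π h s a * f s a)
            - ∑ x, ∑ a,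
                docc (obsInit P0latStar ψ φstar) (obsTrans PlatStar ψ φstar) (compPol π φ) h x
                  * compPol π φ h x a * f (φ h x) a|
          ≤ (∑ s, |P0lat s - ∑ x ∈ Finset.univ.filter (fun x => φ 0 x = s),
                obsInit P0latStar ψ φstar x|)
            + ∑ k ∈ Finset.range h, ∑ x, ∑ a,
                docc (obsInit P0latStar ψ φstar) (obsTrans PlatStar ψ φstar) (compPol π φ) k x
                  * compPol π φ k x a *
                  ∑ s', |Plat k (φ k x) a s'
                    - ∑ x' ∈ Finset.univ.filter (fun x' => φ (k + 1) x' = s'),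
                        obsTrans PlatStar ψ φstar k x a x'| := by
  have hQ0 : ∀ x, 0 ≤ obsInit P0latStar ψ φstar x :=
    fun x => mul_nonneg (h00 _) (hψnn 0 hH _ _)
  have hQ : ∀ k, k + 1 < H → ∀ x a x', 0 ≤ obsTrans PlatStar ψ φstar k x a x' :=
    fun k hk x a x' => mul_nonneg (hPnnStar k hk _ _ _) (hψnn (k + 1) hk _ _)
  have hL1 := (sum_abs_stateAction_sub (φ h) (docc P0lat Plat π h)
      (docc (obsInit P0latStar ψ φstar) (obsTrans PlatStar ψ φstar) (compPol π φ) h)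
      (π h) (hπ h hh)).trans_le
    (sum_abs_docc_sub_pushforward_le hQ0 hQ P0lat hPnn hPsum hπ φ h hh)
  exact ⟨hL1, fun f hf => (abs_expectation_sub_le (φ h)
    (fun s a => docc P0lat Plat π h s * π h s a)
    (fun x a => docc (obsInit P0latStar ψ φstar) (obsTrans PlatStar ψ φstar) (compPol π φ) h x
      * compPol π φ h x a) f hf).trans hL1⟩
end
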